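/- arXiv:2408.06989 — 3 statements merged into one kernel-verified Lean document; each statement's English description precedes it below -/
import Mathlib

section
/- Let n ≥ 2, let x₀ ∈ ℝⁿ, let r₀ > 0, and let γ > γₙ. Then for every C > 0 there exists u ∈ C_c^∞(ℝⁿ) with support contained in the open ball B(x₀, r₀), satisfying (∫_{ℝⁿ} |∇u(x)|ⁿ dx)^{1/n} ≤ 1, such that ∫_{B(x₀,r₀)} exp(γ |u(x)|^{n/(n-1)}) dx > C. In other words, the exponential constant γₙ in the local Moser–Trudinger inequality is sharp. -/
open MeasureTheory Real

/-- Surface measure of the unit sphere `S^{n-1} ⊆ ℝⁿ`, i.e. `ω_{n-1} = n · vol(Bⁿ)`. -/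
noncomputable def sphereArea (n : ℕ) : ℝ :=
  n * (volume (Metric.ball (0 : EuclideanSpace ℝ (Fin n)) 1)).toReal

/-- The sharp Moser-Trudinger constant `γₙ = n ω_{n-1}^{1/(n-1)}`. -/
noncomputable def gammaMT (n : ℕ) : ℝ :=
  n * sphereArea n ^ ((1 : ℝ) / ((n : ℝ) - 1))

/-- `exp_m[t] = e^t − Σ_{k=0}^m t^k/k!`. -/
noncomputable def expRem (m : ℕ) (t : ℝ) : ℝ :=
  Real.exp t - ∑ k ∈ Finset.range (m + 1), t ^ k / (Nat.factorial k)

open Filter Topology Set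

/-- A smooth profile which is constant for `s ≤ 0`, vanishes for `s ≥ L`, slope at most one. -/
lemma exists_profile (L : ℝ) (hL : 2 ≤ L) : ∃ (φ : ℝ → ℝ) (A : ℝ), ContDiff ℝ (⊤ : ℕ∞) φ ∧
    L - 2 ≤ A ∧ (∀ s ≤ 0, φ s = A) ∧ (∀ s, L ≤ s → φ s = 0) ∧ (∀ s, |deriv φ s| ≤ 1) := by
  set χ : ℝ → ℝ := fun s => Real.smoothTransition s * Real.smoothTransition (L - s) with hχ
  have hχs : ContDiff ℝ (⊤ : ℕ∞) χ :=
    Real.smoothTransition.contDiff.mul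
      (Real.smoothTransition.contDiff.comp (contDiff_const.sub contDiff_id))
  have hχc : Continuous χ := hχs.continuous
  have hχ0 : ∀ s, 0 ≤ χ s := fun s =>
    mul_nonneg (Real.smoothTransition.nonneg _) (Real.smoothTransition.nonneg _)
  have hχ1 : ∀ s, χ s ≤ 1 := fun s =>
    mul_le_one₀ (Real.smoothTransition.le_one _) (Real.smoothTransition.nonneg _)
      (Real.smoothTransition.le_one _)
  have hχneg : ∀ s ≤ 0, χ s = 0 := fun s hs => by
    simp [hχ, Real.smoothTransition.zero_of_nonpos hs]
  have hχL : ∀ s, L ≤ s → χ s = 0 := fun s hs => by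
    simp [hχ, Real.smoothTransition.zero_of_nonpos (show L - s ≤ 0 by linarith)]
  have hd : ∀ s, HasDerivAt (fun s => - ∫ t in L..s, χ t) (- χ s) s := fun s =>
    (hχc.integral_hasStrictDerivAt L s).hasDerivAt.neg
  have hder : deriv (fun s => - ∫ t in L..s, χ t) = fun s => - χ s :=
    funext fun s => (hd s).deriv
  refine ⟨fun s => - ∫ t in L..s, χ t, ∫ t in (0:ℝ)..L, χ t, ?_, ?_, ?_, ?_, ?_⟩
  · refine contDiff_infty_iff_deriv.2 ⟨fun s => (hd s).differentiableAt, ?_⟩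
    rw [hder]
    exact hχs.neg
  · have h1 : (∫ t in (1:ℝ)..(L-1), (1:ℝ)) ≤ ∫ t in (1:ℝ)..(L-1), χ t := by
      refine intervalIntegral.integral_mono_on (by linarith) (by simp)
        (hχc.intervalIntegrable _ _) ?_
      intro t ht
      simp only [hχ]
      rw [Real.smoothTransition.one_of_one_le ht.1,
        Real.smoothTransition.one_of_one_le (by linarith [ht.2])]
      norm_num
    have h2 : (∫ t in (1:ℝ)..(L-1), χ t) ≤ ∫ t in (0:ℝ)..L, χ t :=
      intervalIntegral.integral_mono_interval (by norm_num) (by linarith) (by linarith)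
        (Eventually.of_forall hχ0) (hχc.intervalIntegrable _ _)
    simp at h1
    linarith
  · intro s hs
    have h3 : (∫ t in s..(0:ℝ), χ t) = 0 := by
      rw [intervalIntegral.integral_congr (g := fun _ => (0:ℝ))]
      · simp
      · intro t ht
        rw [uIcc_of_le hs] at ht
        exact hχneg t ht.2
    have := intervalIntegral.integral_add_adjacent_intervals
      (hχc.intervalIntegrable (μ := volume) s 0) (hχc.intervalIntegrable (μ := volume) 0 L)
    simp only
    rw [← intervalIntegral.integral_symm]
    linarith
  · intro s hs
    simp only
    rw [intervalIntegral.integral_congr (g := fun _ => (0:ℝ))]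
    · simp
    · intro t ht
      rw [uIcc_of_le hs] at ht
      exact hχL t ht.1
  · intro s
    rw [hder]
    simp only [abs_neg]
    rw [abs_of_nonneg (hχ0 s)]
    exact hχ1 s

lemma radial_integral (n : ℕ) (hn : 2 ≤ n) (ρ R c : ℝ) (hρ : 0 < ρ) (hR : ρ ≤ R) :
    Integrable (fun x : EuclideanSpace ℝ (Fin n) =>
      (Icc ρ R).indicator (fun y : ℝ => (c / y) ^ n) ‖x‖) ∧
    ∫ x : EuclideanSpace ℝ (Fin n), (Icc ρ R).indicator (fun y : ℝ => (c / y) ^ n) ‖x‖ =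
      sphereArea n * (c ^ n * Real.log (R / ρ)) := by
  have : Nonempty (Fin n) := ⟨⟨0, by omega⟩⟩
  have hE : Nontrivial (EuclideanSpace ℝ (Fin n)) := inferInstance
  have hfun : (fun y : ℝ => y ^ (n - 1) • (Icc ρ R).indicator (fun y : ℝ => (c / y) ^ n) y) =
      (Icc ρ R).indicator (fun y : ℝ => c ^ n * y⁻¹) := by
    funext y
    by_cases hy : y ∈ Icc ρ R
    · have hy0 : y ≠ 0 := (hρ.trans_le hy.1).ne'
      rw [indicator_of_mem hy, indicator_of_mem hy, smul_eq_mul]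
      obtain ⟨m, rfl⟩ : ∃ m, n = m + 1 := ⟨n - 1, by omega⟩
      simp only [Nat.add_sub_cancel, div_pow]
      field_simp
      ring
    · rw [indicator_of_notMem hy, indicator_of_notMem hy, smul_zero]
  have hsub : Icc ρ R ⊆ Ioi 0 := fun y hy => hρ.trans_le hy.1
  constructor
  · have := integrable_fun_norm_addHaar (volume : Measure (EuclideanSpace ℝ (Fin n)))
      (f := (Icc ρ R).indicator (fun y : ℝ => (c / y) ^ n))
    rw [this, finrank_euclideanSpace_fin, hfun]
    refine Integrable.integrableOn ?_
    rw [integrable_indicator_iff measurableSet_Icc]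
    refine ContinuousOn.integrableOn_compact isCompact_Icc ?_
    refine continuousOn_const.mul (continuousOn_inv₀.mono fun y hy => (hsub hy).ne')
  · rw [integral_fun_norm_addHaar, finrank_euclideanSpace_fin, hfun,
      setIntegral_indicator measurableSet_Icc, inter_eq_right.2 hsub,
      integral_Icc_eq_integral_Ioc, ← intervalIntegral.integral_of_le hR,
      intervalIntegral.integral_const_mul, integral_inv_of_pos hρ (hρ.trans_le hR)]
    simp [sphereArea, Measure.real, mul_assoc]

lemma exists_moser (n : ℕ) (hn : 2 ≤ n) (R L c : ℝ) (hR : 0 < R) (hL : 2 ≤ L) (hc : 0 < c) :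
    ∃ v : EuclideanSpace ℝ (Fin n) → ℝ, ContDiff ℝ (⊤ : ℕ∞) v ∧
      (∀ x, R ≤ ‖x‖ → v x = 0) ∧
      (∀ x, ‖x‖ < R * Real.exp (-L) → c * (L - 2) ≤ v x) ∧
      (∫ x, ‖fderiv ℝ v x‖ ^ n) ≤ sphereArea n * (c ^ n * L) := by
  obtain ⟨φ, A, hφ, hA, hφ0, hφL, hφ'⟩ := exists_profile L hL
  set ρ := R * Real.exp (-L) with hρdef
  have hρ : 0 < ρ := by positivity
  have hRρ : R / ρ = Real.exp L := by
    rw [hρdef, Real.exp_neg]; field_simp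
  have hρR : ρ ≤ R := by
    have : Real.exp (-L) ≤ 1 := Real.exp_le_one_iff.2 (by linarith)
    rw [hρdef]; nlinarith
  set v : EuclideanSpace ℝ (Fin n) → ℝ := fun x => c * φ (Real.log (‖x‖ / ρ)) with hv
  have hin : ∀ x : EuclideanSpace ℝ (Fin n), ‖x‖ < ρ → v x = c * A := by
    intro x hx
    simp only [hv]
    rw [hφ0]
    exact Real.log_nonpos (by positivity) ((div_le_one hρ).2 hx.le)
  have hout : ∀ x : EuclideanSpace ℝ (Fin n), R ≤ ‖x‖ → v x = 0 := by
    intro x hx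
    simp only [hv]
    rw [hφL, mul_zero]
    rw [← Real.log_exp L, ← hRρ]
    exact Real.log_le_log (by positivity) (by gcongr)
  have hsm : ContDiff ℝ (⊤ : ℕ∞) v := by
    rw [contDiff_iff_contDiffAt]
    intro x
    by_cases hx : x = 0
    · refine (contDiffAt_const (c := c * A)).congr_of_eventuallyEq ?_
      filter_upwards [Metric.ball_mem_nhds x hρ] with y hy
      refine hin y ?_
      simpa [hx] using hy
    · refine contDiffAt_const.mul (hφ.contDiffAt.comp x ?_)
      refine ContDiffAt.log ((contDiffAt_norm ℝ hx).div_const ρ) ?_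
      have := norm_pos_iff.2 hx
      positivity
  have hbound : ∀ x, ‖fderiv ℝ v x‖ ^ n ≤
      (Icc ρ R).indicator (fun y : ℝ => (c / y) ^ n) ‖x‖ := by
    intro x
    have hn0 : n ≠ 0 := by omega
    rcases lt_or_ge ‖x‖ ρ with h1 | h1
    · have : v =ᶠ[𝓝 x] fun _ => c * A := by
        filter_upwards [(isOpen_lt continuous_norm continuous_const).mem_nhds h1] with y hy
        exact hin y hy
      rw [this.fderiv_eq]
      rw [indicator_of_notMem (fun h => absurd h.1 (not_le.2 h1))]
      simp [hn0]
    rcases lt_or_ge R ‖x‖ with h2 | h2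
    · have : v =ᶠ[𝓝 x] fun _ => 0 := by
        filter_upwards [(isOpen_lt continuous_const continuous_norm).mem_nhds h2] with y hy
        exact hout y (le_of_lt hy)
      rw [this.fderiv_eq]
      rw [indicator_of_notMem (fun h => absurd h.2 (not_le.2 h2))]
      simp [hn0]
    rw [indicator_of_mem (show ‖x‖ ∈ Icc ρ R from ⟨h1, h2⟩)]
    have hxp : 0 < ‖x‖ := hρ.trans_le h1
    have hx : x ≠ 0 := norm_pos_iff.1 hxp
    refine pow_le_pow_left₀ (norm_nonneg _) ?_ n
    have hnd : HasFDerivAt (fun y : EuclideanSpace ℝ (Fin n) => ‖y‖)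
        (fderiv ℝ (fun y : EuclideanSpace ℝ (Fin n) => ‖y‖) x) x :=
      ((contDiffAt_norm (n := 1) ℝ hx).differentiableAt (by norm_num)).hasFDerivAt
    have hnle : ‖fderiv ℝ (fun y : EuclideanSpace ℝ (Fin n) => ‖y‖) x‖ ≤ 1 := by
      simpa using norm_fderiv_le_of_lipschitz ℝ
        (lipschitzWith_one_norm (E := EuclideanSpace ℝ (Fin n))) (x₀ := x)
    have hlog : HasDerivAt (fun y : ℝ => c * φ (Real.log (y / ρ)))
        (c * (deriv φ (Real.log (‖x‖ / ρ)) * (1 / ρ / (‖x‖ / ρ)))) ‖x‖ := by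
      have h3 : HasDerivAt φ (deriv φ (Real.log (‖x‖ / ρ))) (Real.log (‖x‖ / ρ)) :=
        ((hφ.differentiable (by simp)) _).hasDerivAt
      have h4 : HasDerivAt (fun y : ℝ => Real.log (y / ρ)) (1 / ρ / (‖x‖ / ρ)) ‖x‖ :=
        ((hasDerivAt_id ‖x‖).div_const ρ).log (by positivity)
      exact (h3.comp ‖x‖ h4).const_mul c
    have hfd := hlog.comp_hasFDerivAt x hnd
    have : fderiv ℝ v x = _ := hfd.fderiv
    rw [this, norm_smul, Real.norm_eq_abs, abs_mul, abs_mul, abs_of_pos hc]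
    have h5 : 1 / ρ / (‖x‖ / ρ) = 1 / ‖x‖ := by field_simp
    rw [h5, abs_of_pos (show 0 < 1 / ‖x‖ by positivity)]
    calc c * (|deriv φ (Real.log (‖x‖ / ρ))| * (1 / ‖x‖)) *
          ‖fderiv ℝ (fun y : EuclideanSpace ℝ (Fin n) => ‖y‖) x‖
        ≤ c * (1 * (1 / ‖x‖)) * 1 := by gcongr; exact hφ' _
      _ = c / ‖x‖ := by ring
  obtain ⟨hi, he⟩ := radial_integral n hn ρ R c hρ hρR
  refine ⟨v, hsm, hout, ?_, ?_⟩
  · intro x hx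
    rw [hin x hx]
    gcongr
  · rw [hRρ, Real.log_exp] at he
    rw [← he]
    exact integral_mono_of_nonneg (Eventually.of_forall fun x => by positivity) hi
      (Eventually.of_forall hbound)

lemma growth (n β a K C : ℝ) (hβ : n < β) (hK : 0 < K) (ha : 0 ≤ a) :
    ∃ L : ℝ, 2 < L ∧ C < K * Real.exp (L * (β * (1 - 2 / L) ^ a - n)) := by
  have h1 : Tendsto (fun L : ℝ => 1 - 2 / L) atTop (𝓝 1) := by
    simpa using (tendsto_const_nhds (x := (1:ℝ))).sub
      ((tendsto_const_nhds (x := (2:ℝ))).div_atTop tendsto_id)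
  have h2 : Tendsto (fun L : ℝ => β * (1 - 2 / L) ^ a - n) atTop (𝓝 (β - n)) := by
    simpa using ((h1.rpow_const (Or.inl one_ne_zero) (p := a)).const_mul β).sub_const n
  have h3 := Filter.Tendsto.atTop_mul_pos (sub_pos.2 hβ) tendsto_id h2
  have h4 := (Real.tendsto_exp_atTop.comp h3).const_mul_atTop hK
  obtain ⟨L, hL, hL'⟩ := ((eventually_gt_atTop 2).and (h4.eventually_gt_atTop C)).exists
  exact ⟨L, hL, hL'⟩

/-- Sharpness of the exponential constant `γₙ` in the local Moser-Trudinger inequality. -/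
theorem local_moser_trudinger_sharp (n : ℕ) (hn : 2 ≤ n)
    (x₀ : EuclideanSpace ℝ (Fin n)) (r₀ : ℝ) (hr₀ : 0 < r₀)
    (γ : ℝ) (hγ : gammaMT n < γ) (C : ℝ) (hC : 0 < C) :
    ∃ u : EuclideanSpace ℝ (Fin n) → ℝ,
      ContDiff ℝ (⊤ : ℕ∞) u ∧ HasCompactSupport u ∧ tsupport u ⊆ Metric.ball x₀ r₀ ∧
      (∫ x, ‖fderiv ℝ u x‖ ^ n) ^ ((1 : ℝ) / n) ≤ 1 ∧
      ENNReal.ofReal C <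
        ∫⁻ x in Metric.ball x₀ r₀,
          ENNReal.ofReal (Real.exp (γ * |u x| ^ ((n : ℝ) / ((n : ℝ) - 1)))) := by
  have hn1 : (0:ℝ) < (n:ℝ) - 1 := by
    have : (2:ℝ) ≤ n := by exact_mod_cast hn
    linarith
  have hn0 : (0:ℝ) < n := by linarith
  have : Nonempty (Fin n) := ⟨⟨0, by omega⟩⟩
  set V := (volume (Metric.ball (0 : EuclideanSpace ℝ (Fin n)) 1)).toReal with hV
  have hVpos : 0 < V :=
    ENNReal.toReal_pos (Metric.measure_ball_pos _ _ one_pos).ne' measure_ball_lt_top.ne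
  set w := sphereArea n with hw
  have hwpos : 0 < w := by rw [hw, sphereArea]; positivity
  set a := (n:ℝ) / ((n:ℝ) - 1) with ha
  have hapos : 0 < a := by positivity
  set R := r₀ / 2 with hR
  have hRpos : 0 < R := by positivity
  set D := w ^ ((1:ℝ) / ((n:ℝ) - 1)) with hD
  have hDpos : 0 < D := by positivity
  have hγpos : 0 < γ := by
    refine lt_trans ?_ hγ
    rw [gammaMT]; positivity
  have hβ : (n:ℝ) < γ / D := by
    rw [lt_div_iff₀ hDpos]; exact hγ
  obtain ⟨L, hL2, hL⟩ := growth n (γ / D) a (V * R ^ n) C hβ (by positivity) hapos.le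
  have hLpos : 0 < L := by linarith
  set c := (w * L) ^ (-(1:ℝ) / n) with hc
  have hcpos : 0 < c := by positivity
  have hcn : c ^ n = (w * L)⁻¹ := by
    rw [hc, ← Real.rpow_natCast, ← Real.rpow_mul (by positivity), ← Real.rpow_neg_one]
    congr 1; field_simp
  have hca : c ^ a = (D * L ^ ((1:ℝ) / ((n:ℝ) - 1)))⁻¹ := by
    rw [hD, ← Real.mul_rpow hwpos.le hLpos.le, hc, ← Real.rpow_mul (by positivity),
      ← Real.rpow_neg (by positivity), ha]
    congr 1; field_simp
  have hkey : γ * (c * (L - 2)) ^ a = L * (γ / D * (1 - 2 / L) ^ a) := by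
    have h1 : L - 2 = L * (1 - 2 / L) := by field_simp
    have h2 : 0 ≤ 1 - 2 / L := by
      rw [sub_nonneg, div_le_one hLpos]; exact hL2.le
    have h3 : L ^ a = L * L ^ ((1:ℝ) / ((n:ℝ) - 1)) := by
      nth_rewrite 2 [← Real.rpow_one L]
      rw [← Real.rpow_add hLpos, ha]
      congr 1; field_simp; ring
    have h4 : 0 < L ^ ((1:ℝ) / ((n:ℝ) - 1)) := by positivity
    rw [h1, Real.mul_rpow hcpos.le (by positivity), Real.mul_rpow hLpos.le h2, hca, h3]
    field_simp
  obtain ⟨v, hv, hvout, hvin, hvint⟩ := exists_moser n hn R L c hRpos hL2.le hcpos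
  have hts : tsupport (fun x => v (x - x₀)) ⊆ Metric.closedBall x₀ R := by
    refine closure_minimal ?_ Metric.isClosed_closedBall
    intro x hx
    by_contra hcon
    rw [Metric.mem_closedBall, dist_eq_norm, not_le] at hcon
    exact hx (hvout _ hcon.le)
  refine ⟨fun x => v (x - x₀), hv.comp (contDiff_id.sub contDiff_const), ?_, ?_, ?_, ?_⟩
  · exact (isCompact_closedBall x₀ R).of_isClosed_subset (isClosed_tsupport _) hts
  · exact hts.trans (Metric.closedBall_subset_ball (by rw [hR]; linarith))
  · have h1 : (∫ x, ‖fderiv ℝ (fun x => v (x - x₀)) x‖ ^ n) = ∫ x, ‖fderiv ℝ v x‖ ^ n := by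
      simp only [fderiv_comp_sub]
      exact integral_sub_right_eq_self (fun x => ‖fderiv ℝ v x‖ ^ n) x₀
    rw [h1]
    refine Real.rpow_le_one (integral_nonneg fun x => by positivity) ?_ (by positivity)
    refine hvint.trans_eq ?_
    rw [hcn, ← hw]; field_simp
  · set ρ := R * Real.exp (-L) with hρ
    have hρpos : 0 < ρ := by positivity
    have hρR : ρ ≤ r₀ := by
      have : Real.exp (-L) ≤ 1 := Real.exp_le_one_iff.2 (by linarith)
      rw [hρ, hR]; nlinarith
    set M := Real.exp (L * (γ / D * (1 - 2 / L) ^ a)) with hM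
    calc ENNReal.ofReal C
        < ENNReal.ofReal (M * (ρ ^ n * V)) := by
          refine (ENNReal.ofReal_lt_ofReal_iff (by positivity)).2 (hL.trans_eq ?_)
          rw [hM, hρ, mul_pow, ← Real.exp_nat_mul, mul_sub, sub_eq_add_neg, Real.exp_add,
            show -(L * (n:ℝ)) = n * -L by ring]
          ring
      _ = ∫⁻ x in Metric.ball x₀ ρ, ENNReal.ofReal M := by
          rw [setLIntegral_const, Measure.addHaar_ball_of_pos _ _ hρpos,
            finrank_euclideanSpace_fin, ENNReal.ofReal_mul (by positivity),
            ENNReal.ofReal_mul (by positivity), hV, ENNReal.ofReal_toReal measure_ball_lt_top.ne]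
      _ ≤ ∫⁻ x in Metric.ball x₀ ρ, ENNReal.ofReal (Real.exp (γ * |v (x - x₀)| ^ a)) := by
          refine setLIntegral_mono' measurableSet_ball fun x hx => ?_
          rw [Metric.mem_ball, dist_eq_norm] at hx
          have h1 := hvin _ hx
          rw [hM, ← hkey]
          have h0 : 0 ≤ c * (L - 2) := mul_nonneg hcpos.le (by linarith)
          have h2 := h1.trans (le_abs_self _)
          gcongr
      _ ≤ _ := lintegral_mono_set (Metric.ball_subset_ball hρR)
end

section
/- Let n ≥ 2, let κ > 0, and let γ > γₙ. Then for every C > 0 there exists u ∈ C_c^∞(ℝⁿ) satisfying ∫_{ℝⁿ} |∇u(x)|ⁿ dx + κ ∫_{ℝⁿ} |u(x)|ⁿ dx ≤ 1 such that ∫_{ℝⁿ} exp_{n-2}[γ |u(x)|^{n/(n-1)}] dx > C. In other words, the exponential constant γₙ in the Ruf–Moser–Trudinger inequality on ℝⁿ is sharp. -/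
open MeasureTheory Real

open Filter Topology

noncomputable def mtPhi (t : ℝ) : ℝ := ∫ s in (0:ℝ)..t, Real.smoothTransition s

lemma mtPhi_hasDerivAt (t : ℝ) : HasDerivAt mtPhi (Real.smoothTransition t) t :=
  intervalIntegral.integral_hasDerivAt_right
    (Real.smoothTransition.continuous.intervalIntegrable _ _)
    (Real.smoothTransition.continuous.stronglyMeasurableAtFilter _ _)
    Real.smoothTransition.continuous.continuousAt

lemma mtPhi_contDiff : ContDiff ℝ (⊤ : ℕ∞) mtPhi := by
  rw [contDiff_infty_iff_deriv]
  refine ⟨fun t => (mtPhi_hasDerivAt t).differentiableAt, ?_⟩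
  have : deriv mtPhi = Real.smoothTransition := funext fun t => (mtPhi_hasDerivAt t).deriv
  rw [this]
  exact Real.smoothTransition.contDiff

lemma mtPhi_of_nonpos {t : ℝ} (ht : t ≤ 0) : mtPhi t = 0 := by
  unfold mtPhi
  rw [intervalIntegral.integral_symm, neg_eq_zero]
  rw [intervalIntegral.integral_congr (g := fun _ => 0)]
  · simp
  · intro x hx
    rw [Set.uIcc_of_le ht] at hx
    exact Real.smoothTransition.zero_of_nonpos hx.2

lemma mtPhi_nonneg (t : ℝ) : 0 ≤ mtPhi t := by
  rcases le_total t 0 with h | h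
  · rw [mtPhi_of_nonpos h]
  · exact intervalIntegral.integral_nonneg h fun x _ => Real.smoothTransition.nonneg x

lemma mtPhi_le {t : ℝ} (ht : 0 ≤ t) : mtPhi t ≤ t := by
  have := intervalIntegral.integral_mono_on (μ := volume) ht
    (Real.smoothTransition.continuous.intervalIntegrable 0 t)
    (continuous_const.intervalIntegrable (μ := volume) (u := fun _ : ℝ => (1:ℝ)) 0 t)
    (fun x _ => Real.smoothTransition.le_one x)
  simpa [mtPhi] using this

lemma le_mtPhi (t : ℝ) : t - 1 ≤ mtPhi t := by
  rcases le_total t 1 with h | h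
  · linarith [mtPhi_nonneg t]
  · have h1 : mtPhi t = mtPhi 1 + ∫ s in (1:ℝ)..t, Real.smoothTransition s :=
      (intervalIntegral.integral_add_adjacent_intervals
        (Real.smoothTransition.continuous.intervalIntegrable _ _)
        (Real.smoothTransition.continuous.intervalIntegrable _ _)).symm
    have h2 : ∫ s in (1:ℝ)..t, Real.smoothTransition s = t - 1 := by
      rw [intervalIntegral.integral_congr (g := fun _ => 1)]
      · simp
      · intro x hx
        rw [Set.uIcc_of_le h] at hx
        exact Real.smoothTransition.one_of_one_le hx.1
    linarith [mtPhi_nonneg 1]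

lemma radial_bound (n : ℕ) (hn : 2 ≤ n) (v : EuclideanSpace ℝ (Fin n) → ℝ) (B : ℝ → ℝ)
    (hB : IntegrableOn B (Set.Ioo 0 1))
    (hv0 : ∀ x, 0 ≤ v x) (hv1 : ∀ x, 1 ≤ ‖x‖ → v x = 0)
    (hv : ∀ x, 0 < ‖x‖ → ‖x‖ < 1 → v x ≤ (‖x‖ ^ (n - 1))⁻¹ * B ‖x‖) :
    ∫ x, v x ≤ sphereArea n * ∫ r in Set.Ioo 0 1, B r := by
  have : Nonempty (Fin n) := ⟨⟨0, by omega⟩⟩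
  set F : ℝ → ℝ := (Set.Ioo (0:ℝ) 1).indicator (fun r => (r ^ (n - 1))⁻¹ * B r) with hF
  have hd : Module.finrank ℝ (EuclideanSpace ℝ (Fin n)) = n := by simp
  have key : Set.EqOn (fun y : ℝ => y ^ (n - 1) • F y) ((Set.Ioo (0:ℝ) 1).indicator B) (Set.Ioi 0) := by
    intro y hy
    have hy : (0:ℝ) < y := hy
    by_cases h : y ∈ Set.Ioo (0:ℝ) 1
    · simp only [hF, Set.indicator_of_mem h, smul_eq_mul]
      field_simp
    · simp [hF, Set.indicator_of_notMem h]
  have hsub : Set.Ioi (0:ℝ) ∩ Set.Ioo 0 1 = Set.Ioo 0 1 := by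
    ext x; simp
  have hFi : Integrable (fun x : EuclideanSpace ℝ (Fin n) => F ‖x‖) := by
    rw [integrable_fun_norm_addHaar, hd, integrableOn_congr_fun key measurableSet_Ioi]
    exact ((integrable_indicator_iff measurableSet_Ioo).2 hB).integrableOn
  calc ∫ x, v x ≤ ∫ x : EuclideanSpace ℝ (Fin n), F ‖x‖ := by
        apply integral_mono_of_nonneg (ae_of_all _ hv0) hFi
        have : ∀ᵐ x : EuclideanSpace ℝ (Fin n), x ≠ 0 := by
          simp [ae_iff]
        filter_upwards [this] with x hx
        have hx' := norm_pos_iff.2 hx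
        by_cases h : ‖x‖ < 1
        · simp only [hF, Set.indicator_of_mem (show ‖x‖ ∈ Set.Ioo (0:ℝ) 1 from ⟨hx', h⟩)]
          exact hv x hx' h
        · rw [hv1 x (not_lt.1 h), hF, Set.indicator_of_notMem (fun h' => h h'.2)]
    _ = sphereArea n * ∫ r in Set.Ioo 0 1, B r := by
        rw [integral_fun_norm_addHaar, hd, setIntegral_congr_fun measurableSet_Ioi key,
          setIntegral_indicator measurableSet_Ioo, hsub]
        simp [sphereArea, Measure.real]
        ring

lemma expRem_lower (m : ℕ) : ∀ᶠ t in atTop, Real.exp t / 2 ≤ expRem m t := by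
  have h : (fun t : ℝ => ∑ k ∈ Finset.range (m + 1), t ^ k / (Nat.factorial k : ℝ)) =o[atTop] Real.exp := by
    apply Asymptotics.IsLittleO.fun_sum
    intro k _
    simpa [div_eq_inv_mul] using (isLittleO_pow_exp_atTop (n := k)).const_mul_left ((Nat.factorial k : ℝ)⁻¹)
  have := h.def (c := 1/2) (by norm_num)
  filter_upwards [this] with t ht
  rw [Real.norm_eq_abs, Real.norm_eq_abs, abs_of_pos (Real.exp_pos t)] at ht
  have := le_abs_self (∑ k ∈ Finset.range (m + 1), t ^ k / (Nat.factorial k : ℝ))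
  unfold expRem
  linarith

lemma int_kernel (δ : ℝ) (hδ : 0 < δ) : 
    IntegrableOn (fun r : ℝ => r / (r ^ 2 + δ)) (Set.Ioo 0 1) ∧ 
    ∫ r in Set.Ioo (0:ℝ) 1, r / (r ^ 2 + δ) = (Real.log (1 + δ) - Real.log δ) / 2 := by
  have hc : Continuous (fun r : ℝ => r / (r ^ 2 + δ)) :=
    continuous_id.div (by fun_prop) (fun r => by positivity)
  constructor
  · exact (hc.integrableOn_Icc (a := 0) (b := 1)).mono_set Set.Ioo_subset_Icc_self
  · rw [← integral_Ioc_eq_integral_Ioo, ← intervalIntegral.integral_of_le zero_le_one]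
    rw [intervalIntegral.integral_eq_sub_of_hasDerivAt (f := fun r => Real.log (r ^ 2 + δ) / 2)]
    · simp; ring
    · intro x _
      have : HasDerivAt (fun r : ℝ => r ^ 2 + δ) (2 * x) x := by
        simpa using (hasDerivAt_pow 2 x).add_const δ
      have hx : x ^ 2 + δ ≠ 0 := by positivity
      exact ((this.log hx).div_const 2).congr_deriv (by field_simp)
    · exact hc.intervalIntegrable _ _

/-- the truncated logarithm -/
noncomputable def mtG (n : ℕ) (δ : ℝ) (x : EuclideanSpace ℝ (Fin n)) : ℝ :=
  -(1/2) * Real.log (‖x‖ ^ 2 + δ)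

lemma mtG_hasFDerivAt (n : ℕ) (δ : ℝ) (hδ : 0 < δ) (x : EuclideanSpace ℝ (Fin n)) :
    HasFDerivAt (mtG n δ) ((-(1/2) : ℝ) • ((‖x‖ ^ 2 + δ)⁻¹ • (2 • (innerSL ℝ x)))) x := by
  have h := (hasStrictFDerivAt_norm_sq x).hasFDerivAt.add_const δ
  exact (h.log (by positivity)).const_mul _

lemma mtG_contDiff (n : ℕ) (δ : ℝ) (hδ : 0 < δ) : ContDiff ℝ (⊤ : ℕ∞) (mtG n δ) := by
  unfold mtG
  refine contDiff_const.mul (ContDiff.log ((contDiff_norm_sq ℝ).add contDiff_const) ?_)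
  intro x; positivity

lemma mtG_nonpos (n : ℕ) (δ : ℝ) (hδ : 0 < δ) (x : EuclideanSpace ℝ (Fin n)) (hx : 1 ≤ ‖x‖) :
    mtG n δ x ≤ 0 := by
  have : 0 ≤ Real.log (‖x‖ ^ 2 + δ) := Real.log_nonneg (by nlinarith)
  unfold mtG; linarith

lemma mtU_fderiv (n : ℕ) (δ A : ℝ) (hδ : 0 < δ) (hA : 0 < A) (x : EuclideanSpace ℝ (Fin n)) :
    ‖fderiv ℝ (fun x => A * mtPhi (mtG n δ x)) x‖ =
      A * Real.smoothTransition (mtG n δ x) * (‖x‖ / (‖x‖ ^ 2 + δ)) := by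
  have h := (((mtPhi_hasDerivAt (mtG n δ x)).comp_hasFDerivAt x (mtG_hasFDerivAt n δ hδ x)).const_mul A).fderiv
  simp only [Function.comp_def] at h
  rw [h]
  have h0 := Real.smoothTransition.nonneg (mtG n δ x)
  have hp : 0 < ‖x‖ ^ 2 + δ := by positivity
  rw [← Nat.cast_smul_eq_nsmul ℝ]
  simp only [norm_smul, innerSL_apply_norm, Real.norm_eq_abs, abs_of_pos hA, abs_of_nonneg h0, abs_inv, abs_of_pos hp]
  norm_num
  field_simp

lemma mtG_bound {r δ : ℝ} (hδ : 0 < δ) (h0 : 0 < r) (h1 : r < 1) (n : ℕ) (hn : 2 ≤ n) :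
    mtPhi (-(1/2) * Real.log (r ^ 2 + δ)) ^ n ≤ (r ^ (n-1))⁻¹ * 2 ^ n := by
  set s := Real.sqrt r with hs
  have hs0 : 0 < s := Real.sqrt_pos.2 h0
  have hsr : s ^ 2 = r := Real.sq_sqrt h0.le
  have hs1 : s ≤ 1 := by nlinarith
  have ha : mtPhi (-(1/2) * Real.log (r ^ 2 + δ)) ≤ 2 / s := by
    rcases le_total (-(1/2) * Real.log (r ^ 2 + δ)) 0 with h | h
    · rw [mtPhi_of_nonpos h]; positivity
    · refine (mtPhi_le h).trans ?_
      have h2 : Real.log (r ^ 2) ≤ Real.log (r ^ 2 + δ) := Real.log_le_log (by positivity) (by linarith)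
      have h3 : Real.log (r ^ 2) = 4 * Real.log s := by
        rw [← hsr, ← pow_mul, Real.log_pow]; norm_num
      have h4 := Real.log_le_sub_one_of_pos (inv_pos.2 hs0)
      rw [Real.log_inv] at h4
      rw [div_eq_mul_inv 2 s]
      linarith
  calc _ ≤ (2 / s) ^ n := pow_le_pow_left₀ (mtPhi_nonneg _) ha n
    _ = (s ^ n)⁻¹ * 2 ^ n := by rw [div_pow]; field_simp
    _ ≤ _ := by
      apply mul_le_mul_of_nonneg_right _ (by positivity)
      apply inv_anti₀ (by positivity)
      rw [← hsr, ← pow_mul]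
      exact pow_le_pow_of_le_one hs0.le hs1 (by omega)

lemma sphereArea_pos (n : ℕ) (hn : 2 ≤ n) : 0 < sphereArea n := by
  unfold sphereArea
  have : 0 < (volume (Metric.ball (0 : EuclideanSpace ℝ (Fin n)) 1)).toReal :=
    ENNReal.toReal_pos (Metric.measure_ball_pos _ _ one_pos).ne' measure_ball_lt_top.ne
  have : (0:ℝ) < n := by exact_mod_cast (by omega : 0 < n)
  positivity

lemma mt_energy (n : ℕ) (hn : 2 ≤ n) (κ : ℝ) (hκ : 0 < κ) (T A : ℝ) (hT : 0 < T) (hA : 0 < A) :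
    (∫ x, ‖fderiv ℝ (fun x : EuclideanSpace ℝ (Fin n) => A * mtPhi (mtG n (Real.exp (-2 * T)) x)) x‖ ^ n)
     + κ * (∫ x : EuclideanSpace ℝ (Fin n), |A * mtPhi (mtG n (Real.exp (-2 * T)) x)| ^ n)
     ≤ A ^ n * (sphereArea n * (T + (1 + κ * 2 ^ n))) := by
  set δ := Real.exp (-2 * T) with hδ'
  have hδ : 0 < δ := Real.exp_pos _
  have hδ1 : δ ≤ 1 := Real.exp_le_one_iff.2 (by linarith)
  obtain ⟨hi, hI⟩ := int_kernel δ hδ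
  have hω := sphereArea_pos n hn
  have h1 : (∫ x, ‖fderiv ℝ (fun x : EuclideanSpace ℝ (Fin n) => A * mtPhi (mtG n δ x)) x‖ ^ n)
     ≤ sphereArea n * ∫ r in Set.Ioo (0:ℝ) 1, A ^ n * (r / (r ^ 2 + δ)) := by
    apply radial_bound n hn _ _ (hi.const_mul _)
    · intro x; positivity
    · intro x hx
      rw [mtU_fderiv n δ A hδ hA, Real.smoothTransition.zero_of_nonpos (mtG_nonpos n δ hδ x hx)]
      simp; omega
    · intro x hx _
      rw [mtU_fderiv n δ A hδ hA]
      set r := ‖x‖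
      have hp : 0 < r ^ 2 + δ := by positivity
      have hs0 := Real.smoothTransition.nonneg (mtG n δ x)
      calc (A * Real.smoothTransition (mtG n δ x) * (r / (r ^ 2 + δ))) ^ n
          ≤ (A * 1 * (r / (r ^ 2 + δ))) ^ n := by
            gcongr; exact Real.smoothTransition.le_one _
        _ = A ^ n * ((r / (r ^ 2 + δ)) * (r / (r ^ 2 + δ)) ^ (n - 1)) := by
            rw [mul_one, mul_pow, ← pow_succ', Nat.sub_add_cancel (by omega)]
        _ ≤ A ^ n * ((r / (r ^ 2 + δ)) * (r⁻¹) ^ (n - 1)) := by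
            have : r / (r ^ 2 + δ) ≤ r⁻¹ := by
              rw [inv_eq_one_div, div_le_div_iff₀ hp hx]; nlinarith
            gcongr
        _ = _ := by rw [inv_pow]; ring
  have h2 : (∫ x : EuclideanSpace ℝ (Fin n), |A * mtPhi (mtG n δ x)| ^ n)
     ≤ sphereArea n * ∫ r in Set.Ioo (0:ℝ) 1, A ^ n * 2 ^ n := by
    apply radial_bound n hn _ _ (integrableOn_const (by simp))
    · intro x; positivity
    · intro x hx
      rw [mtPhi_of_nonpos (mtG_nonpos n δ hδ x hx)]
      simp; omega
    · intro x hx hx1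
      rw [abs_of_nonneg (mul_nonneg hA.le (mtPhi_nonneg _)), mul_pow]
      have := mtG_bound hδ hx hx1 n hn
      unfold mtG
      calc _ ≤ A ^ n * ((‖x‖ ^ (n-1))⁻¹ * 2 ^ n) := by gcongr
        _ = _ := by ring
  rw [integral_const_mul, hI] at h1
  have h3 : Real.log δ = -2 * T := Real.log_exp _
  have h4 : Real.log (1 + δ) ≤ 1 := by
    have := Real.log_le_sub_one_of_pos (show 0 < 1 + δ by linarith)
    linarith
  have h5 : (∫ r in Set.Ioo (0:ℝ) 1, A ^ n * 2 ^ n) = A ^ n * 2 ^ n := by simp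
  rw [h5] at h2
  have h6 : sphereArea n * (A ^ n * ((Real.log (1 + δ) - Real.log δ) / 2)) ≤ sphereArea n * (A ^ n * (T + 1)) := by
    gcongr; rw [h3]; linarith
  have h7 := mul_le_mul_of_nonneg_left h2 hκ.le
  calc _ ≤ sphereArea n * (A ^ n * (T + 1)) + κ * (sphereArea n * (A ^ n * 2 ^ n)) := by linarith
    _ = _ := by ring

lemma mt_choice (n : ℕ) (hn : 2 ≤ n) (γ ω K C v : ℝ) (hω : 0 < ω) (hK : 0 < K) (hv : 0 < v)
    (hγ : n * ω ^ ((1:ℝ) / ((n:ℝ) - 1)) < γ) (m : ℕ) :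
    ∃ T A : ℝ, 2 < T ∧ 0 < A ∧ A ^ n * (ω * (T + K)) ≤ 1 ∧ 
      ∃ S, C < S * (Real.exp (-T) ^ n * v) ∧ 0 < S ∧
        ∀ t, γ * (A * (T - 2)) ^ ((n:ℝ) / ((n:ℝ) - 1)) ≤ t → S ≤ expRem m t := by
  set q : ℝ := (1:ℝ) / ((n:ℝ) - 1) with hq
  have hn2 : (2:ℝ) ≤ n := by exact_mod_cast hn
  have hn1 : (0:ℝ) < (n:ℝ) - 1 := by linarith
  have hq0 : 0 < q := by positivity
  have hωq : 0 < ω ^ q := Real.rpow_pos_of_pos hω q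
  have hγ' : (n:ℝ) < γ / ω ^ q := by rwa [lt_div_iff₀ hωq]
  have hγ0 : 0 < γ := lt_trans (by positivity) hγ
  obtain ⟨b, hb1, hb2⟩ := exists_between hγ'
  have hlim : Tendsto (fun T : ℝ => γ / ω ^ q * ((T - 2) / (T + K)) ^ q) atTop (𝓝 (γ / ω ^ q * 1 ^ q)) := by
    refine Tendsto.const_mul _ (Tendsto.rpow_const ?_ (Or.inl one_ne_zero))
    have h1 : Tendsto (fun T : ℝ => 1 - (2 + K) / (T + K)) atTop (𝓝 (1 - 0)) :=
      tendsto_const_nhds.sub (tendsto_const_nhds.div_atTop (tendsto_atTop_add_const_right _ _ tendsto_id))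
    rw [sub_zero] at h1
    refine h1.congr' ?_
    filter_upwards [eventually_gt_atTop 0] with T hT
    have : T + K ≠ 0 := by positivity
    field_simp; ring
  rw [Real.one_rpow, mul_one] at hlim
  have hb0 : 0 < b := by linarith
  have e1 := hlim.eventually (lt_mem_nhds hb2)
  have hS : Tendsto (fun T : ℝ => b * (T - 2)) atTop atTop :=
    (tendsto_atTop_add_const_right _ (-2) tendsto_id).const_mul_atTop hb0
  have e2 := hS.eventually (eventually_forall_ge_atTop.2 (expRem_lower m))
  have hE : Tendsto (fun T : ℝ => v / 2 * Real.exp ((b - n) * T + (- (b * 2)))) atTop atTop :=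
    ((Real.tendsto_exp_atTop.comp (tendsto_atTop_add_const_right _ _
      (tendsto_id.const_mul_atTop (sub_pos.2 hb1)))).const_mul_atTop (by positivity))
  have e3 := hE.eventually (eventually_gt_atTop C)
  obtain ⟨T, h1, h2, h3, hT⟩ := (e1.and (e2.and (e3.and (eventually_gt_atTop 2)))).exists
  have hD : 0 < ω * (T + K) := by positivity
  have hT2 : 0 < T - 2 := by linarith
  refine ⟨T, (ω * (T + K)) ^ (-(1:ℝ) / n), hT, by positivity, ?_, Real.exp (b * (T - 2)) / 2, ?_, by positivity, ?_⟩
  · rw [← Real.rpow_natCast, ← Real.rpow_mul hD.le]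
    rw [div_mul_cancel₀ _ (by positivity), Real.rpow_neg_one, inv_mul_cancel₀ hD.ne']
  · refine lt_of_lt_of_eq h3 ?_
    rw [← Real.exp_nat_mul]
    have : (b - n) * T + -(b * 2) = b * (T - 2) + n * -T := by ring
    rw [this, Real.exp_add]; ring
  · intro t ht
    have hkey : b * (T - 2) ≤ t := by
      refine le_trans ?_ ht
      have hp : (n:ℝ) / ((n:ℝ) - 1) = 1 + q := by rw [hq]; field_simp; ring
      have hpn : (-(1:ℝ) / n) * ((n:ℝ) / ((n:ℝ) - 1)) = - q := by rw [hq]; field_simp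
      rw [Real.mul_rpow (by positivity) hT2.le, ← Real.rpow_mul hD.le, hpn, hp,
        Real.rpow_add hT2, Real.rpow_one, Real.rpow_neg hD.le, Real.mul_rpow hω.le (by positivity)]
      rw [Real.div_rpow hT2.le (by positivity)] at h1
      calc b * (T - 2) ≤ (γ / ω ^ q * ((T - 2) ^ q / (T + K) ^ q)) * (T - 2) := by gcongr
        _ = _ := by field_simp
    refine le_trans ?_ (h2 t hkey)
    gcongr

/-- Sharpness of the exponential constant `γₙ` in the Ruf-Moser-Trudinger inequality on `ℝⁿ`. -/
theorem ruf_moser_trudinger_sharp (n : ℕ) (hn : 2 ≤ n) (κ : ℝ) (hκ : 0 < κ)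
    (γ : ℝ) (hγ : gammaMT n < γ) (C : ℝ) (hC : 0 < C) :
    ∃ u : EuclideanSpace ℝ (Fin n) → ℝ,
      ContDiff ℝ (⊤ : ℕ∞) u ∧ HasCompactSupport u ∧
      (∫ x, ‖fderiv ℝ u x‖ ^ n) + κ * (∫ x, |u x| ^ n) ≤ 1 ∧
      ENNReal.ofReal C <
        ∫⁻ x,
          ENNReal.ofReal (expRem (n - 2) (γ * |u x| ^ ((n : ℝ) / ((n : ℝ) - 1)))) := by
  have hv : 0 < (volume (Metric.ball (0 : EuclideanSpace ℝ (Fin n)) 1)).toReal :=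
    ENNReal.toReal_pos (Metric.measure_ball_pos _ _ one_pos).ne' measure_ball_lt_top.ne
  have : Nonempty (Fin n) := ⟨⟨0, by omega⟩⟩
  have hω := sphereArea_pos n hn
  have hn2 : (2:ℝ) ≤ n := by exact_mod_cast hn
  have hn1 : (0:ℝ) < (n:ℝ) - 1 := by linarith
  have hγ0 : 0 < γ := lt_trans (by unfold gammaMT; positivity) hγ
  obtain ⟨T, A, hT, hA, hE, S, hCS, hS0, hS⟩ :=
    mt_choice n hn γ (sphereArea n) (1 + κ * 2 ^ n) C _ hω (by positivity) hv hγ (n - 2)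
  have hδ : 0 < Real.exp (-2 * T) := Real.exp_pos _
  refine ⟨fun x => A * mtPhi (mtG n (Real.exp (-2 * T)) x), ?_, ?_, ?_, ?_⟩
  · exact contDiff_const.mul (mtPhi_contDiff.comp (mtG_contDiff n _ hδ))
  · refine HasCompactSupport.intro (isCompact_closedBall 0 1) ?_
    intro x hx
    rw [mem_closedBall_zero_iff, not_le] at hx
    rw [mtPhi_of_nonpos (mtG_nonpos n _ hδ x hx.le), mul_zero]
  · exact (mt_energy n hn κ hκ T A (by linarith) hA).trans hE
  · have hvol : volume (Metric.ball (0 : EuclideanSpace ℝ (Fin n)) (Real.exp (-T))) =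
        ENNReal.ofReal (Real.exp (-T) ^ n *
          (volume (Metric.ball (0 : EuclideanSpace ℝ (Fin n)) 1)).toReal) := by
      rw [Measure.addHaar_ball _ _ (Real.exp_pos _).le, ENNReal.ofReal_mul (by positivity),
        ENNReal.ofReal_toReal measure_ball_lt_top.ne]
      simp
    calc ENNReal.ofReal C < ENNReal.ofReal (S * (Real.exp (-T) ^ n *
          (volume (Metric.ball (0 : EuclideanSpace ℝ (Fin n)) 1)).toReal)) :=
          (ENNReal.ofReal_lt_ofReal_iff (hC.trans hCS)).2 hCS
      _ = ∫⁻ x in Metric.ball (0 : EuclideanSpace ℝ (Fin n)) (Real.exp (-T)), ENNReal.ofReal S := by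
          rw [setLIntegral_const, hvol, ENNReal.ofReal_mul hS0.le]
      _ ≤ ∫⁻ x in Metric.ball (0 : EuclideanSpace ℝ (Fin n)) (Real.exp (-T)), 
          ENNReal.ofReal (expRem (n - 2) (γ * |A * mtPhi (mtG n (Real.exp (-2 * T)) x)| ^ ((n : ℝ) / ((n : ℝ) - 1)))) := by
          refine setLIntegral_mono' Metric.isOpen_ball.measurableSet ?_
          intro x hx
          apply ENNReal.ofReal_le_ofReal
          apply hS
          rw [mem_ball_zero_iff] at hx
          have hsq : Real.exp (-2 * T) = Real.exp (-T) ^ 2 := by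
            rw [← Real.exp_nat_mul]; congr 1; push_cast; ring
          have hg : T - 1 ≤ mtG n (Real.exp (-2 * T)) x := by
            unfold mtG
            have h1 : ‖x‖ ^ 2 + Real.exp (-2 * T) ≤ 2 * Real.exp (-2 * T) := by
              rw [hsq]; nlinarith [norm_nonneg x]
            have h2 := Real.log_le_log (by positivity) h1
            rw [Real.log_mul two_ne_zero hδ.ne', Real.log_exp] at h2
            have := Real.log_two_lt_d9
            linarith
          have hp := le_mtPhi (mtG n (Real.exp (-2 * T)) x)
          rw [abs_of_nonneg (mul_nonneg hA.le (mtPhi_nonneg _))]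
          have : 0 ≤ T - 2 := by linarith
          gcongr
          linarith
      _ ≤ _ := setLIntegral_le_lintegral _ _
end

section
/- Let n ≥ 2 and let Ω ⊆ ℝⁿ be an open set with infinite inradius, i.e. for every R > 0 there exists x ∈ ℝⁿ with B(x,R) ⊆ Ω. Then for every γ > 0 and every C > 0 there exists u ∈ C_c^∞(Ω) with (∫_Ω |∇u(x)|ⁿ dx)^{1/n} ≤ 1 and ∫_Ω exp_{n-2}[γ |u(x)|^{n/(n-1)}] dx > C. In other words, the Moser–Trudinger inequality fails on Ω for every exponential constant γ > 0. -/
open MeasureTheory Real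

/-- On an open set `Ω ⊆ ℝⁿ` with infinite inradius, the Moser-Trudinger inequality fails
for every exponential constant `γ > 0`. -/
theorem moser_trudinger_fails_of_infinite_inradius (n : ℕ) (hn : 2 ≤ n)
    (Ω : Set (EuclideanSpace ℝ (Fin n))) (hΩ : IsOpen Ω)
    (hinr : ∀ R > (0 : ℝ), ∃ x : EuclideanSpace ℝ (Fin n), Metric.ball x R ⊆ Ω)
    (γ : ℝ) (hγ : 0 < γ) (C : ℝ) (hC : 0 < C) :
    ∃ u : EuclideanSpace ℝ (Fin n) → ℝ,
      ContDiff ℝ (⊤ : ℕ∞) u ∧ HasCompactSupport u ∧ tsupport u ⊆ Ω ∧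
      (∫ x in Ω, ‖fderiv ℝ u x‖ ^ n) ^ ((1 : ℝ) / n) ≤ 1 ∧
      ENNReal.ofReal C <
        ∫⁻ x in Ω,
          ENNReal.ofReal (expRem (n - 2) (γ * |u x| ^ ((n : ℝ) / ((n : ℝ) - 1)))) := by
  let φ : ContDiffBump (0 : EuclideanSpace ℝ (Fin n)) := ⟨1, 2, by norm_num, by norm_num⟩
  have hφs : ContDiff ℝ (⊤ : ℕ∞) (φ : EuclideanSpace ℝ (Fin n) → ℝ) := φ.contDiff
  have hfr : Module.finrank ℝ (EuclideanSpace ℝ (Fin n)) = n := by simp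
  obtain ⟨M, hM0, hM⟩ : ∃ M : ℝ, 0 < M ∧ ∀ x, ‖fderiv ℝ (φ : EuclideanSpace ℝ (Fin n) → ℝ) x‖ ≤ M := by
    have hc : Continuous (fderiv ℝ (φ : EuclideanSpace ℝ (Fin n) → ℝ)) := hφs.continuous_fderiv (by simp)
    obtain ⟨M, hM⟩ := hc.bounded_above_of_compact_support
      (φ.hasCompactSupport.fderiv (𝕜 := ℝ))
    exact ⟨max M 1, by positivity, fun x => (hM x).trans (le_max_left _ _)⟩
  set V : ℝ := (volume (Metric.ball (0 : EuclideanSpace ℝ (Fin n)) 1)).toReal with hV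
  have hVfin : volume (Metric.ball (0 : EuclideanSpace ℝ (Fin n)) 1) ≠ ⊤ := measure_ball_lt_top.ne
  have hV0 : 0 < V := ENNReal.toReal_pos (Metric.measure_ball_pos _ _ one_pos).ne' hVfin
  have hvol : ∀ (x : EuclideanSpace ℝ (Fin n)) (r : ℝ), 0 ≤ r →
      volume (Metric.closedBall x r) = ENNReal.ofReal (r ^ n * V) := by
    intro x r hr
    rw [Measure.addHaar_closedBall _ x hr, hfr, ENNReal.ofReal_mul (by positivity), hV,
      ENNReal.ofReal_toReal hVfin]
  set a : ℝ := 1 / (2 * M * (V + 1)) with ha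
  have ha0 : 0 < a := by positivity
  set e : ℝ := expRem (n - 2) (γ * a ^ ((n : ℝ) / ((n : ℝ) - 1))) with he
  have he0 : 0 < e := by
    have ht : 0 < γ * a ^ ((n : ℝ) / ((n : ℝ) - 1)) := by positivity
    have h := Real.sum_le_exp_of_nonneg ht.le (n - 2 + 1 + 1)
    rw [Finset.sum_range_succ] at h
    have : 0 < (γ * a ^ ((n : ℝ) / ((n : ℝ) - 1))) ^ (n - 2 + 1) /
        ((Nat.factorial (n - 2 + 1) : ℕ) : ℝ) := by positivity
    rw [he, expRem]
    linarith
  set R : ℝ := C / (e * V) + 1 with hR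
  have hCR : 0 < C / (e * V) := by positivity
  have hR1 : 1 ≤ R := by linarith
  have hR0 : 0 < R := by linarith
  obtain ⟨x₀, hx₀⟩ := hinr (3 * R) (by positivity)
  let u : EuclideanSpace ℝ (Fin n) → ℝ := fun x => a * φ (R⁻¹ • (x - x₀))
  have hin : ∀ x, 2 * R ≤ dist x x₀ → u x = 0 := by
    intro x hx
    have : φ (R⁻¹ • (x - x₀)) = 0 := by
      apply φ.zero_of_le_dist
      rw [dist_zero_right, norm_smul, ← dist_eq_norm, norm_inv, Real.norm_of_nonneg hR0.le]
      change 2 ≤ _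
      rw [inv_mul_eq_div, le_div_iff₀ hR0]
      exact hx
    simp [u, this]
  have hone : ∀ x ∈ Metric.closedBall x₀ R, u x = a := by
    intro x hx
    have : φ (R⁻¹ • (x - x₀)) = 1 := by
      apply φ.one_of_mem_closedBall
      rw [Metric.mem_closedBall, dist_zero_right, norm_smul, ← dist_eq_norm, norm_inv,
        Real.norm_of_nonneg hR0.le]
      change _ ≤ (1 : ℝ)
      rw [inv_mul_eq_div, div_le_iff₀ hR0, one_mul]
      exact hx
    simp [u, this]
  have hts : tsupport u ⊆ Metric.closedBall x₀ (2 * R) := by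
    apply closure_minimal _ Metric.isClosed_closedBall
    intro x hx
    by_contra h
    rw [Metric.mem_closedBall, not_le] at h
    exact hx (hin x h.le)
  have hBΩ : Metric.closedBall x₀ (2 * R) ⊆ Ω :=
    (Metric.closedBall_subset_ball (by linarith)).trans hx₀
  have hfd : ∀ x, ‖fderiv ℝ u x‖ ≤ a * M / R := by
    intro x
    have h1 : HasFDerivAt (fun x : EuclideanSpace ℝ (Fin n) => R⁻¹ • (x - x₀)) (R⁻¹ • ContinuousLinearMap.id ℝ (EuclideanSpace ℝ (Fin n))) x :=
      ((hasFDerivAt_id x).sub_const x₀).const_smul R⁻¹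
    have h2 : HasFDerivAt (φ : EuclideanSpace ℝ (Fin n) → ℝ) (fderiv ℝ (φ : EuclideanSpace ℝ (Fin n) → ℝ) (R⁻¹ • (x - x₀)))
        (R⁻¹ • (x - x₀)) :=
      (hφs.differentiable (by simp) _).hasFDerivAt
    have h3 : HasFDerivAt u _ x := (h2.comp x h1).const_mul a
    rw [h3.fderiv, ContinuousLinearMap.comp_smul, ContinuousLinearMap.comp_id, norm_smul,
      norm_smul, norm_inv, Real.norm_of_nonneg hR0.le, Real.norm_of_nonneg ha0.le, mul_div_assoc,
      inv_mul_eq_div]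
    gcongr
    exact hM _
  refine ⟨u, ?_, ?_, hts.trans hBΩ, ?_, ?_⟩
  · exact contDiff_const.mul (hφs.comp ((contDiff_id.sub contDiff_const).const_smul R⁻¹))
  · exact (isCompact_closedBall x₀ (2 * R)).of_isClosed_subset (isClosed_tsupport u) hts
  · apply Real.rpow_le_one
    · exact integral_nonneg fun x => by positivity
    · have h1 : ∫ x in Ω, ‖fderiv ℝ u x‖ ^ n
          = ∫ x in Metric.closedBall x₀ (2 * R), ‖fderiv ℝ u x‖ ^ n := by
        apply setIntegral_eq_of_subset_of_forall_diff_eq_zero hΩ.measurableSet hBΩ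
        intro x hx
        have : fderiv ℝ u x = 0 := by
          by_contra h
          exact hx.2 (hts (support_fderiv_subset ℝ h))
        rw [this, norm_zero, zero_pow (by omega)]
      rw [h1]
      have h2 := norm_setIntegral_le_of_norm_le_const (μ := volume)
        (s := Metric.closedBall x₀ (2 * R)) (f := fun x => ‖fderiv ℝ u x‖ ^ n)
        (C := (a * M / R) ^ n) measure_closedBall_lt_top
        (fun x _ => by
          rw [norm_pow, norm_norm]
          exact pow_le_pow_left₀ (norm_nonneg _) (hfd x) n)
      refine (le_abs_self _).trans (h2.trans ?_)
      rw [Measure.real, hvol _ _ (by positivity), ENNReal.toReal_ofReal (by positivity),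
        ← mul_assoc, ← mul_pow]
      have h3 : a * M / R * (2 * R) = 1 / (V + 1) := by
        rw [ha]; field_simp
      rw [h3]
      calc (1 / (V + 1)) ^ n * V ≤ (1 / (V + 1)) * V := by
            gcongr
            apply pow_le_of_le_one (by positivity) _ (by omega)
            rw [div_le_one (by positivity)]; linarith
        _ ≤ 1 := by rw [one_div_mul_eq_div, div_le_one (by positivity)]; linarith
    · positivity
  · have hsub : Metric.closedBall x₀ R ⊆ Ω :=
      (Metric.closedBall_subset_closedBall (by linarith)).trans hBΩ
    refine lt_of_lt_of_le ?_ (lintegral_mono_set hsub)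
    have h1 : ∫⁻ x in Metric.closedBall x₀ R,
          ENNReal.ofReal (expRem (n - 2) (γ * |u x| ^ ((n : ℝ) / ((n : ℝ) - 1))))
        = ∫⁻ x in Metric.closedBall x₀ R, ENNReal.ofReal e := by
      apply setLIntegral_congr_fun Metric.isClosed_closedBall.measurableSet
      intro x hx
      simp only [hone x hx, abs_of_pos ha0, he]
    rw [h1, setLIntegral_const, hvol _ _ hR0.le, ← ENNReal.ofReal_mul he0.le]
    rw [ENNReal.ofReal_lt_ofReal_iff (by positivity)]
    have h2 : R ≤ R ^ n := le_self_pow₀ hR1 (by omega)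
    calc C < C + e * V := by linarith [mul_pos he0 hV0]
      _ = e * (R * V) := by rw [hR]; field_simp
      _ ≤ e * (R ^ n * V) := by gcongr
end
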